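/- (Peskine–Szpiro Vanishing) Let (R,m) be a commutative Noetherian regular local ring of prime characteristic p and let I be a proper ideal of R. Then H^j_I(R) = 0 for every integer j > dim R − depth(R/I); that is, lcd_R(I) ≤ dim R − depth(R/I). -/

import Mathlib

open CategoryTheory

/-- The depth of a module `M` over a Noetherian local ring `(R, 𝔪, k)`, defined (following the
standard characterization) as the least `i` with `Ext^i_R(k, M) ≠ 0`, as an element of `ℕ∞`. -/
noncomputable def moduleDepth (R : Type) [CommRing R] [IsLocalRing R]
    (M : Type) [AddCommGroup M] [Module R M] : ℕ∞ :=
  sInf {n : ℕ∞ | ∃ i : ℕ, n = i ∧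
    Nontrivial (((Ext R (ModuleCat R) i).obj
        (Opposite.op (ModuleCat.of R (R ⧸ IsLocalRing.maximalIdeal R)))).obj
      (ModuleCat.of R M))}

section RegularLocalRing

open IsLocalRing RingTheory.Sequence
open scoped Pointwise

lemma exists_isPrime_natCast_le_ringKrullDim_quotient {R : Type*} [CommRing R] {n : ℕ}
    (h : (n : WithBot ℕ∞) ≤ ringKrullDim R) :
    ∃ P : Ideal R, P.IsPrime ∧ (n : WithBot ℕ∞) ≤ ringKrullDim (R ⧸ P) := by
  obtain ⟨l, rfl⟩ := Order.le_krullDim_iff.mp h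
  refine ⟨l.head.asIdeal, l.head.isPrime, ?_⟩
  rw [ringKrullDim_quotient, Order.le_krullDim_iff]
  have hmem (i : Fin (l.length + 1)) :
      l i ∈ PrimeSpectrum.zeroLocus (l.head.asIdeal : Set R) := by
    rw [PrimeSpectrum.mem_zeroLocus, SetLike.coe_subset_coe, PrimeSpectrum.asIdeal_le_asIdeal]
    exact l.strictMono.monotone (Fin.zero_le i)
  exact ⟨⟨l.length, fun i => ⟨l i, hmem i⟩, fun i => l.step i⟩, rfl⟩

lemma ringKrullDim_le_ringKrullDim_quotient_span_singleton_add_one {R : Type*} [CommRing R]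
    [IsNoetherianRing R] [IsLocalRing R] {x : R} (hx : x ∈ maximalIdeal R) :
    ringKrullDim R ≤ ringKrullDim (R ⧸ Ideal.span {x}) + 1 := by
  have h := ringKrullDim_le_ringKrullDim_quotient_add_card {x}
    (by simpa [ringJacobson_eq_maximalIdeal] using hx)
  rwa [Finset.coe_singleton, Finset.card_singleton, Nat.cast_one] at h

lemma ringKrullDim_le_length_of_ofList_eq_maximalIdeal {R : Type*} [CommRing R]
    [IsNoetherianRing R] [IsLocalRing R] {rs : List R}
    (hrs : Ideal.ofList rs = maximalIdeal R) : ringKrullDim R ≤ rs.length := by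
  classical
  refine (ringKrullDim_le_spanFinrank_maximalIdeal R).trans ?_
  norm_cast
  have hset : {r | r ∈ rs} = (rs.toFinset : Set R) := by ext; simp
  rw [← hrs, Ideal.ofList, hset]
  refine (Submodule.spanFinrank_span_le_ncard_of_finite (Finset.finite_toSet _)).trans ?_
  rw [Set.ncard_coe_finset]
  exact rs.toFinset_card_le

/-- The induction step in the proof that regular local rings are domains: if `R / (x)` is a domain
of dimension at most `n` and `R` has dimension at least `n + 1`, then `R` is a domain. -/
lemma isDomain_of_isDomain_quotient_span_singleton {R : Type*} [CommRing R]
    [IsNoetherianRing R] [IsLocalRing R] {x : R} (hx : x ∈ maximalIdeal R)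
    [IsDomain (R ⧸ Ideal.span {x})] {n : ℕ} (hle : ringKrullDim (R ⧸ Ideal.span {x}) ≤ n)
    (hge : ((n + 1 : ℕ) : WithBot ℕ∞) ≤ ringKrullDim R) : IsDomain R := by
  obtain ⟨P, hP, hdim⟩ := exists_isPrime_natCast_le_ringKrullDim_quotient hge
  have := IsLocalRing.of_surjective' _ (Ideal.Quotient.mk_surjective (I := P))
  have hmk : Ideal.Quotient.mk P x ∈ maximalIdeal (R ⧸ P) := by
    rw [← IsLocalRing.map_maximalIdeal_of_surjective _ Ideal.Quotient.mk_surjective]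
    exact Ideal.mem_map_of_mem _ hx
  have hquot : (n : WithBot ℕ∞) ≤
      ringKrullDim ((R ⧸ P) ⧸ Ideal.span {Ideal.Quotient.mk P x}) := by
    have h := hdim.trans (ringKrullDim_le_ringKrullDim_quotient_span_singleton_add_one hmk)
    push_cast at h
    exact ENat.WithBot.add_le_add_one_right_iff.mp h
  have hxP : x ∉ P := by
    intro hxP
    have h := hdim.trans ((ringKrullDim_le_of_surjective
      (Ideal.Quotient.factor ((Ideal.span_singleton_le_iff_mem P).mpr hxP))
      (Ideal.Quotient.factor_surjective _)).trans hle)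
    norm_cast at h
    lia
  have hPx : P ≤ Ideal.span {x} := by
    intro y hy
    by_contra hyx
    let f : R ⧸ Ideal.span {x} →+* (R ⧸ P) ⧸ Ideal.span {Ideal.Quotient.mk P x} :=
      Ideal.Quotient.lift _ ((Ideal.Quotient.mk _).comp (Ideal.Quotient.mk P)) (by
        intro a ha
        obtain ⟨b, rfl⟩ := Ideal.mem_span_singleton'.mp ha
        rw [RingHom.comp_apply, Ideal.Quotient.eq_zero_iff_mem, map_mul]
        exact Ideal.mul_mem_left _ _ (Ideal.mem_span_singleton_self _))
    have hf : Function.Surjective f := Ideal.Quotient.lift_surjective_of_surjective _ _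
      (Ideal.Quotient.mk_surjective.comp Ideal.Quotient.mk_surjective)
    have hy0 : Ideal.Quotient.mk (Ideal.span {x}) y ≠ 0 := by
      rwa [Ne, Ideal.Quotient.eq_zero_iff_mem]
    have h := (ringKrullDim_succ_le_of_surjective f hf (mem_nonZeroDivisors_of_ne_zero hy0)
      (by simp [f, Ideal.Quotient.eq_zero_iff_mem.mpr hy])).trans hle
    have h' := (add_le_add_left hquot 1).trans h
    norm_cast at h'
    lia
  have hbot : P = ⊥ := by
    refine Submodule.eq_bot_of_le_smul_of_le_jacobson_bot (Ideal.span {x}) P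
      (IsNoetherian.noetherian P) ?_ ?_
    · intro y hy
      obtain ⟨a, rfl⟩ := Ideal.mem_span_singleton'.mp (hPx hy)
      rw [smul_eq_mul, mul_comm a x]
      exact Ideal.mul_mem_mul (Ideal.mem_span_singleton_self x)
        ((hP.mem_or_mem hy).resolve_right hxP)
    · rw [jacobson_eq_maximalIdeal ⊥ bot_ne_top]
      exact (Ideal.span_singleton_le_iff_mem _).mpr hx
  subst hbot
  exact IsDomain.of_bot_isPrime R

theorem isDomain_and_isWeaklyRegular_of_ofList_eq_maximalIdeal {R : Type*} [CommRing R]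
    [IsNoetherianRing R] [IsLocalRing R] (rs : List R)
    (hrs : Ideal.ofList rs = maximalIdeal R) (hdim : (rs.length : WithBot ℕ∞) ≤ ringKrullDim R) :
    IsDomain R ∧ IsWeaklyRegular R rs := by
  obtain ⟨n, hn⟩ : ∃ n, rs.length = n := ⟨_, rfl⟩
  induction n generalizing R with
  | zero =>
    obtain rfl := List.length_eq_zero_iff.mp hn
    rw [Ideal.ofList_nil, eq_comm, ← isField_iff_maximalIdeal_eq] at hrs
    exact ⟨hrs.isDomain, IsWeaklyRegular.nil R R⟩
  | succ n ih =>
    obtain ⟨x, rs, rfl⟩ := List.exists_cons_of_length_eq_add_one hn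
    rw [List.length_cons] at hn hdim
    have hx : x ∈ maximalIdeal R := by
      rw [← hrs, Ideal.ofList_cons]
      exact Ideal.mem_sup_left (Ideal.mem_span_singleton_self x)
    have : Nontrivial (R ⧸ Ideal.span {x}) := Ideal.Quotient.nontrivial_iff.mpr fun h =>
      (maximalIdeal.isMaximal R).ne_top
        (top_le_iff.mp (h ▸ (Ideal.span_singleton_le_iff_mem _).mpr hx))
    have := IsLocalRing.of_surjective' _ (Ideal.Quotient.mk_surjective (I := Ideal.span {x}))
    have hmax : Ideal.ofList (rs.map (Ideal.Quotient.mk (Ideal.span {x}))) =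
        maximalIdeal (R ⧸ Ideal.span {x}) := by
      rw [← IsLocalRing.map_maximalIdeal_of_surjective _ Ideal.Quotient.mk_surjective, ← hrs,
        Ideal.ofList_cons, Ideal.map_sup, Ideal.map_quotient_self, bot_sup_eq, Ideal.map_ofList]
    have hlen : (rs.map (Ideal.Quotient.mk (Ideal.span {x}))).length = n := by
      simpa using hn
    obtain ⟨hdom, hreg⟩ := ih _ hmax (by
      have h := hdim.trans (ringKrullDim_le_ringKrullDim_quotient_span_singleton_add_one hx)
      push_cast at h
      rw [List.length_map]
      exact ENat.WithBot.add_le_add_one_right_iff.mp h) hlen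
    have hdomR : IsDomain R := isDomain_of_isDomain_quotient_span_singleton hx
      ((ringKrullDim_le_length_of_ofList_eq_maximalIdeal hmax).trans_eq (by rw [hlen]))
      (by rwa [hn] at hdim)
    have hx0 : x ≠ 0 := by
      rintro rfl
      have h1 := ringKrullDim_le_length_of_ofList_eq_maximalIdeal hmax
      rw [List.length_map, ringKrullDim_eq_of_ringEquiv
        ((Ideal.quotEquivOfEq (Ideal.span_singleton_eq_bot.mpr rfl)).trans
          (RingEquiv.quotientBot R))] at h1
      have h2 := hdim.trans h1
      norm_cast at h2
      lia
    refine ⟨hdomR, .cons (IsSMulRegular.of_ne_zero hx0) ?_⟩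
    rw [← Ideal.Quotient.algebraMap_eq, isWeaklyRegular_map_algebraMap_iff] at hreg
    refine ((Submodule.quotEquivOfEq _ _ ?_).isWeaklyRegular_congr rs).mpr hreg
    rw [← Submodule.ideal_span_singleton_smul, smul_eq_mul, Ideal.mul_top]


lemma RingTheory.Sequence.IsWeaklyRegular.of_subsingleton {R M : Type*} [CommRing R]
    [AddCommGroup M] [Module R M] [Subsingleton M] (rs : List R) : IsWeaklyRegular M rs := by
  induction rs generalizing M with
  | nil => exact .nil R M
  | cons r rs ih =>
    have : Subsingleton (QuotSMulTop r M) :=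
      (Submodule.Quotient.mk_surjective (r • (⊤ : Submodule R M))).subsingleton
    exact .cons (Function.injective_of_subsingleton _) ih

lemma RingTheory.Sequence.IsWeaklyRegular.of_shortExact {R M M' M'' : Type*} [CommRing R]
    [AddCommGroup M] [Module R M] [AddCommGroup M'] [Module R M'] [AddCommGroup M''] [Module R M'']
    {f : M →ₗ[R] M'} {g : M' →ₗ[R] M''} (hf : Function.Injective f) (hfg : Function.Exact f g)
    (hg : Function.Surjective g) {rs : List R} (h : IsWeaklyRegular M rs)
    (h'' : IsWeaklyRegular M'' rs) : IsWeaklyRegular M' rs := by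
  induction rs generalizing M M' M'' with
  | nil => exact .nil R M'
  | cons r rs ih =>
    rw [isWeaklyRegular_cons_iff] at h h''
    refine .cons (isSMulRegular_of_range_eq_ker hf hfg.linearMap_ker_eq.symm h.1 h''.1)
      (ih (f := QuotSMulTop.map r f) (g := QuotSMulTop.map r g) ?_
        (QuotSMulTop.map_exact r hfg hg) (QuotSMulTop.map_surjective r hg) h.2 h''.2)
    have h0 : Function.Exact (0 : M →ₗ[R] M) f := by
      rw [LinearMap.exact_zero_iff_injective]
      exact hf
    have h1 := QuotSMulTop.map_first_exact_on_four_term_exact_of_isSMulRegular_last h0 hfg h''.1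
    rwa [map_zero, LinearMap.exact_zero_iff_injective] at h1

lemma RingTheory.Sequence.IsWeaklyRegular.quotSMulTop_pow {R M : Type*} [CommRing R]
    [AddCommGroup M] [Module R M] {r : R} {rs : List R} (hr : IsSMulRegular M r)
    (h : IsWeaklyRegular (QuotSMulTop r M) rs) (a : ℕ) :
    IsWeaklyRegular (QuotSMulTop (r ^ a) M) rs := by
  induction a with
  | zero =>
    have : Subsingleton (QuotSMulTop (r ^ 0) M) := by
      rw [QuotSMulTop, pow_zero, one_smul]
      exact Submodule.Quotient.subsingleton_iff.mpr rfl
    exact .of_subsingleton rs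
  | succ a ih =>
    have hf : r ^ a • (⊤ : Submodule R M) ≤
        (r ^ (a + 1) • (⊤ : Submodule R M)).comap (LinearMap.lsmul R M r) := by
      intro y hy
      obtain ⟨z, -, rfl⟩ := (Submodule.mem_smul_pointwise_iff_exists _ _ _).mp hy
      rw [Submodule.mem_comap, LinearMap.lsmul_apply, smul_smul, ← pow_succ']
      exact Submodule.smul_mem_pointwise_smul _ _ _ trivial
    have hg : r ^ (a + 1) • (⊤ : Submodule R M) ≤ r • (⊤ : Submodule R M) := by
      intro y hy
      obtain ⟨z, -, rfl⟩ := (Submodule.mem_smul_pointwise_iff_exists _ _ _).mp hy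
      rw [pow_succ', ← smul_smul]
      exact Submodule.smul_mem_pointwise_smul _ _ _ trivial
    refine .of_shortExact (f := Submodule.mapQ _ _ (LinearMap.lsmul R M r) hf)
      (g := Submodule.factor hg) ?_ ?_ (Submodule.factor_surjective hg) ih h
    · rw [injective_iff_map_eq_zero]
      intro y hy
      obtain ⟨y, rfl⟩ := Submodule.Quotient.mk_surjective _ y
      rw [Submodule.mapQ_apply, Submodule.Quotient.mk_eq_zero] at hy
      obtain ⟨z, -, hz⟩ := (Submodule.mem_smul_pointwise_iff_exists _ _ _).mp hy
      rw [pow_succ', ← smul_smul] at hz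
      rw [Submodule.Quotient.mk_eq_zero, ← hr hz]
      exact Submodule.smul_mem_pointwise_smul _ _ _ trivial
    · intro y
      obtain ⟨y, rfl⟩ := Submodule.Quotient.mk_surjective _ y
      constructor
      · intro hy
        rw [← Submodule.mkQ_apply, Submodule.factor_mk, Submodule.mkQ_apply,
          Submodule.Quotient.mk_eq_zero] at hy
        obtain ⟨z, -, rfl⟩ := (Submodule.mem_smul_pointwise_iff_exists _ _ _).mp hy
        exact ⟨Submodule.Quotient.mk z, rfl⟩
      · rintro ⟨z, hz⟩
        obtain ⟨z, rfl⟩ := Submodule.Quotient.mk_surjective _ z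
        rw [← hz, Submodule.mapQ_apply, ← Submodule.mkQ_apply, Submodule.factor_mk,
          Submodule.mkQ_apply, Submodule.Quotient.mk_eq_zero]
        exact Submodule.smul_mem_pointwise_smul _ _ _ trivial

lemma RingTheory.Sequence.IsWeaklyRegular.map_pow {R M : Type*} [CommRing R]
    [AddCommGroup M] [Module R M] {rs : List R} (h : IsWeaklyRegular M rs) (a : ℕ) :
    IsWeaklyRegular M (rs.map (· ^ a)) := by
  induction rs generalizing M with
  | nil => exact .nil R M
  | cons r rs ih =>
    rw [isWeaklyRegular_cons_iff] at h
    exact .cons (h.1.pow a) (ih (h.2.quotSMulTop_pow h.1 a))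

section Flat

open TensorProduct

variable {R S : Type*} [CommRing R] [CommRing S] [Algebra R S]

variable (S) in
/-- The multiplication map `S ⊗ J → S` attached to an ideal `J` of `R` and an `R`-algebra `S`. -/
noncomputable def Ideal.tensorMul (J : Ideal R) : S ⊗[R] J →ₗ[S] S :=
  (AlgebraTensorModule.rid R S S).toLinearMap ∘ₗ J.subtype.baseChange S

@[simp]
lemma Ideal.tensorMul_tmul (J : Ideal R) (s : S) (c : J) :
    J.tensorMul S (s ⊗ₜ c) = (c : R) • s := rfl

lemma Ideal.tensorMul_lTensor_inclusion {J J' : Ideal R} (h : J ≤ J') (t : S ⊗[R] J) :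
    J'.tensorMul S ((Submodule.inclusion h).lTensor S t) = J.tensorMul S t := by
  induction t with
  | zero => simp
  | add a b ha hb => simp [ha, hb]
  | tmul a c => simp

lemma Ideal.range_tensorMul (J : Ideal R) :
    LinearMap.range (J.tensorMul S) = J.map (algebraMap R S) := by
  apply le_antisymm
  · rintro _ ⟨t, rfl⟩
    induction t with
    | zero => simp
    | add a b ha hb => rw [map_add]; exact add_mem ha hb
    | tmul a c =>
      rw [tensorMul_tmul, Algebra.smul_def]
      exact Ideal.mul_mem_right _ _ (Ideal.mem_map_of_mem _ c.2)
  · rw [Ideal.map, Ideal.span_le]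
    rintro _ ⟨c, hc, rfl⟩
    exact ⟨1 ⊗ₜ ⟨c, hc⟩, by simp [Algebra.smul_def]⟩

lemma Module.Flat.of_injective_tensorMul
    (h : ∀ J : Ideal R, Function.Injective (J.tensorMul S)) : Module.Flat R S := by
  rw [Module.Flat.iff_lTensor_injective']
  exact fun J => (h J).of_comp (f := AlgebraTensorModule.rid R S S)

/-- The map `J × R → J ⊔ (x)` given by `(c, r) ↦ c + r x`. -/
def Ideal.prodToSupSpan (J : Ideal R) (x : R) : J × R →ₗ[R] (J ⊔ Ideal.span {x} : Ideal R) :=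
  LinearMap.coprod (Submodule.inclusion le_sup_left) (LinearMap.toSpanSingleton R _
    ⟨x, Ideal.mem_sup_right (Ideal.mem_span_singleton_self x)⟩)

lemma Ideal.prodToSupSpan_surjective (J : Ideal R) (x : R) :
    Function.Surjective (J.prodToSupSpan x) := by
  rintro ⟨y, hy⟩
  obtain ⟨c, hc, z, hz, rfl⟩ := Submodule.mem_sup.mp hy
  obtain ⟨r, rfl⟩ := Ideal.mem_span_singleton'.mp hz
  exact ⟨(⟨c, hc⟩, r), by ext; simp [prodToSupSpan]⟩

/-- Multiplication by `x` as a map `(J : x) → J`. -/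
def Ideal.colonMul (J : Ideal R) (x : R) :
    (Submodule.comap (LinearMap.mulLeft R x) J : Ideal R) →ₗ[R] J :=
  (LinearMap.mulLeft R x).restrict fun _ h => h

lemma Ideal.exact_colonMul_prodToSupSpan (J : Ideal R) (x : R) :
    Function.Exact ((J.colonMul x).prod (-Submodule.subtype _)) (J.prodToSupSpan x) := by
  rintro ⟨c, r⟩
  constructor
  · intro h
    have h' : (c : R) + r * x = 0 := by simpa [prodToSupSpan, Subtype.ext_iff] using h
    refine ⟨⟨-r, ?_⟩, ?_⟩
    · have h'' : x * -r = c := by linear_combination -h'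
      simp only [Submodule.mem_comap, LinearMap.mulLeft_apply, h'']
      exact c.2
    · ext
      · change x * -r = c
        linear_combination -h'
      · simp
  · rintro ⟨c, h⟩
    rw [← h]
    ext
    simp [prodToSupSpan, colonMul, mul_comm]

lemma Ideal.exists_eq_lTensor_inclusion_add_tmul (J : Ideal R) (x : R)
    (y : S ⊗[R] (J ⊔ Ideal.span {x} : Ideal R)) : ∃ (z : S ⊗[R] J) (s : S),
      y = (Submodule.inclusion le_sup_left).lTensor S z +
        s ⊗ₜ ⟨x, Ideal.mem_sup_right (Ideal.mem_span_singleton_self x)⟩ := by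
  induction y with
  | zero => exact ⟨0, 0, by simp⟩
  | add a b ha hb =>
    obtain ⟨z, s, rfl⟩ := ha
    obtain ⟨z', s', rfl⟩ := hb
    exact ⟨z + z', s + s', by rw [map_add, add_tmul]; abel⟩
  | tmul a c =>
    obtain ⟨⟨c, r⟩, rfl⟩ := J.prodToSupSpan_surjective x c
    exact ⟨a ⊗ₜ c, r • a, by simp [prodToSupSpan, tmul_add, smul_tmul]⟩

lemma Ideal.exists_lTensor_colonMul_eq (J : Ideal R) (x : R) (z : S ⊗[R] J)
    (hz : (Submodule.inclusion (le_sup_left : J ≤ J ⊔ Ideal.span {x})).lTensor S z = 0) :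
    ∃ w, (J.colonMul x).lTensor S w = z ∧ Ideal.tensorMul S _ w = 0 := by
  have h0 : (J.prodToSupSpan x).lTensor S ((LinearMap.inl R J R).lTensor S z) = 0 := by
    rw [← LinearMap.lTensor_comp_apply, prodToSupSpan, LinearMap.coprod_inl, hz]
  obtain ⟨w, hw⟩ := (lTensor_exact S (J.exact_colonMul_prodToSupSpan x)
    (J.prodToSupSpan_surjective x) _).mp h0
  refine ⟨w, ?_, ?_⟩
  · have h := congrArg ((LinearMap.fst R J R).lTensor S) hw
    rwa [← LinearMap.lTensor_comp_apply, ← LinearMap.lTensor_comp_apply, LinearMap.fst_prod,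
      LinearMap.fst_comp_inl, LinearMap.lTensor_id_apply] at h
  · have h := congrArg ((LinearMap.snd R J R).lTensor S) hw
    rw [← LinearMap.lTensor_comp_apply, ← LinearMap.lTensor_comp_apply, LinearMap.snd_prod,
      LinearMap.snd_comp_inl, LinearMap.lTensor_zero, LinearMap.lTensor_neg,
      LinearMap.zero_apply, LinearMap.neg_apply, neg_eq_zero] at h
    exact (congrArg (AlgebraTensorModule.rid R S S) h).trans (map_zero _)

lemma Ideal.tensorMul_sup_span_injective {J : Ideal R} {x : R}
    (hJ : Function.Injective (J.tensorMul S))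
    (hx : ∀ s, algebraMap R S x * s ∈ J.map (algebraMap R S) → s ∈ J.map (algebraMap R S)) :
    Function.Injective ((J ⊔ Ideal.span {x}).tensorMul S) := by
  rw [injective_iff_map_eq_zero]
  intro y hy
  obtain ⟨z, s, rfl⟩ := J.exists_eq_lTensor_inclusion_add_tmul x y
  rw [map_add, tensorMul_lTensor_inclusion, tensorMul_tmul, Algebra.smul_def] at hy
  obtain ⟨t, rfl⟩ : s ∈ LinearMap.range (J.tensorMul S) := by
    rw [range_tensorMul]
    refine hx s ?_
    rw [eq_neg_of_add_eq_zero_right hy, ← range_tensorMul]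
    exact neg_mem ⟨z, rfl⟩
  have hz : z = -(algebraMap R S x • t) := by
    apply hJ
    rw [map_neg, map_smul, smul_eq_mul]
    exact eq_neg_of_add_eq_zero_left hy
  rw [hz, map_neg, neg_add_eq_zero]
  clear hy hz z
  induction t with
  | zero => simp
  | add a b ha hb => rw [smul_add, map_add, ha, hb, map_add, add_tmul]
  | tmul a c =>
    rw [smul_tmul', smul_eq_mul, ← Algebra.smul_def, LinearMap.lTensor_tmul, tensorMul_tmul,
      smul_tmul, smul_tmul]
    congr 1
    ext
    simp [mul_comm]

lemma Ideal.tensorMul_ofList_injective {rs : List R}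
    (h : IsWeaklyRegular S (rs.map (algebraMap R S))) :
    Function.Injective ((Ideal.ofList rs).tensorMul S) := by
  induction rs using List.reverseRecOn with
  | nil =>
    rw [Ideal.ofList_nil]
    have : Subsingleton (S ⊗[R] (⊥ : Ideal R)) := inferInstance
    exact Function.injective_of_subsingleton _
  | append_singleton rs x ih =>
    rw [List.map_append, isWeaklyRegular_append_iff] at h
    rw [Ideal.ofList_append, Ideal.ofList_singleton]
    refine tensorMul_sup_span_injective (ih h.1) ?_
    have hx := h.2
    rw [List.map_singleton, isWeaklyRegular_singleton_iff,
      isSMulRegular_quotient_iff_mem_of_smul_mem, smul_eq_mul, Ideal.mul_top,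
      ← Ideal.map_ofList] at hx
    exact hx

variable [IsNoetherianRing R] [IsLocalRing R] [IsNoetherianRing S] [IsLocalRing S]
  [IsLocalHom (algebraMap R S)]

lemma Ideal.tensorMul_injective_of_maximalIdeal
    (h : Function.Injective ((maximalIdeal R).tensorMul S)) (J : Ideal R) :
    Function.Injective (J.tensorMul S) := by
  induction J using WellFoundedGT.induction with
  | ind J ih =>
  by_cases hJ : maximalIdeal R ≤ J
  · by_cases htop : J = ⊤
    · subst htop
      intro a b hab
      have hinv (t : S ⊗[R] (⊤ : Ideal R)) :
          t = (⊤ : Ideal R).tensorMul S t ⊗ₜ ⟨1, trivial⟩ := by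
        induction t with
        | zero => simp
        | add a b ha hb => rw [map_add, add_tmul, ← ha, ← hb]
        | tmul a c =>
          rw [tensorMul_tmul, smul_tmul]
          congr 1
          ext
          simp
      rw [hinv a, hab, ← hinv b]
    · rwa [hJ.antisymm (IsLocalRing.le_maximalIdeal htop)] at h
  · obtain ⟨x, hx, hxJ⟩ := SetLike.not_le_iff_exists.mp hJ
    have hlt : J < J ⊔ Ideal.span {x} := left_lt_sup.mpr
      (by rwa [Ideal.span_singleton_le_iff_mem])
    have hle : J ≤ Submodule.comap (LinearMap.mulLeft R x) J := fun c hc =>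
      Ideal.mul_mem_left _ _ hc
    have key (z : S ⊗[R] J) (hz : J.tensorMul S z = 0) :
        ∃ w, (J.colonMul x).lTensor S w = z ∧ Ideal.tensorMul S _ w = 0 := by
      refine J.exists_lTensor_colonMul_eq x z (ih _ hlt ?_)
      rw [tensorMul_lTensor_inclusion, hz, map_zero]
    rw [← LinearMap.ker_eq_bot]
    rcases hle.lt_or_eq with hcolon | hcolon
    · rw [eq_bot_iff]
      intro z hz
      obtain ⟨w, rfl, hw⟩ := key z hz
      rw [ih _ hcolon (hw.trans (map_zero _).symm), map_zero]
      exact zero_mem _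
    · refine Submodule.eq_bot_of_le_smul_of_le_jacobson_bot (maximalIdeal S) _
        (IsNoetherian.noetherian _) ?_ (jacobson_eq_maximalIdeal ⊥ bot_ne_top).ge
      intro z hz
      obtain ⟨w, rfl, hw⟩ := key z hz
      have hw' : (J.colonMul x).lTensor S w =
          algebraMap R S x • (Submodule.inclusion hcolon.ge).lTensor S w := by
        clear hw hz
        induction w with
        | zero => simp
        | add a b ha hb => rw [map_add, map_add, ha, hb, smul_add]
        | tmul a c =>
          rw [LinearMap.lTensor_tmul, LinearMap.lTensor_tmul, smul_tmul', smul_eq_mul,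
            ← Algebra.smul_def, smul_tmul]
          rfl
      rw [hw']
      refine Submodule.smul_mem_smul ?_ ?_
      · exact IsLocalRing.map_maximalIdeal_le (algebraMap R S) (Ideal.mem_map_of_mem _ hx)
      · rw [LinearMap.mem_ker, tensorMul_lTensor_inclusion, hw]

theorem Module.Flat.of_isWeaklyRegular_map {rs : List R} (hrs : Ideal.ofList rs = maximalIdeal R)
    (h : IsWeaklyRegular S (rs.map (algebraMap R S))) : Module.Flat R S :=
  .of_injective_tensorMul <| Ideal.tensorMul_injective_of_maximalIdeal <| by
    rw [← hrs]
    exact Ideal.tensorMul_ofList_injective h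

end Flat

lemma RingHom.Flat.of_isWeaklyRegular_map {R S : Type*} [CommRing R] [CommRing S]
    [IsNoetherianRing R] [IsLocalRing R] [IsNoetherianRing S] [IsLocalRing S] (f : R →+* S)
    [IsLocalHom f] {rs : List R} (hrs : Ideal.ofList rs = maximalIdeal R)
    (h : IsWeaklyRegular S (rs.map f)) : f.Flat := by
  algebraize [f]
  exact Module.Flat.of_isWeaklyRegular_map hrs h

/-- One direction of Kunz's theorem: the Frobenius endomorphism of a regular local ring is flat. -/
lemma flat_frobenius_of_isWeaklyRegular {R : Type*} [CommRing R] [IsNoetherianRing R]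
    [IsLocalRing R] (p : ℕ) [ExpChar R p] {rs : List R} (hrs : Ideal.ofList rs = maximalIdeal R)
    (h : IsWeaklyRegular R rs) : (frobenius R p).Flat := by
  have : IsLocalHom (frobenius R p) :=
    ⟨fun a ha => (isUnit_pow_iff (expChar_ne_zero R p)).mp ha⟩
  exact .of_isWeaklyRegular_map _ hrs (h.map_pow p)

end RegularLocalRing

section ProjectiveDimension

open TensorProduct

universe u

lemma ModuleCat.shortExact_of_exact {R K F M : Type u} [CommRing R] [AddCommGroup K]
    [Module R K] [AddCommGroup F] [Module R F] [AddCommGroup M] [Module R M]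
    {f : K →ₗ[R] F} {g : F →ₗ[R] M} (hf : Function.Injective f) (hfg : Function.Exact f g)
    (hg : Function.Surjective g) :
    (ModuleCat.shortComplexOfCompEqZero f g hfg.linearMap_comp_eq_zero).ShortExact where
  exact := (ShortComplex.ShortExact.moduleCat_exact_iff_function_exact _).mpr hfg
  mono_f := (ModuleCat.mono_iff_injective _).mpr hf
  epi_g := (ModuleCat.epi_iff_surjective _).mpr hg

lemma ModuleCat.hasProjectiveDimensionLT_iff_of_exact {R K F M : Type u} [CommRing R]
    [AddCommGroup K] [Module R K] [AddCommGroup F] [Module R F] [AddCommGroup M] [Module R M]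
    [Module.Projective R F] {f : K →ₗ[R] F} {g : F →ₗ[R] M} (hf : Function.Injective f)
    (hfg : Function.Exact f g) (hg : Function.Surjective g) (n : ℕ) :
    HasProjectiveDimensionLT (ModuleCat.of R M) (n + 2) ↔
      HasProjectiveDimensionLT (ModuleCat.of R K) (n + 1) :=
  (ModuleCat.shortExact_of_exact hf hfg hg).hasProjectiveDimensionLT_X₃_iff n
    (ModuleCat.projective_of_categoryTheory_projective (.of R F))

lemma ModuleCat.hasProjectiveDimensionLT_tensorProduct {R S : Type u} [CommRing R] [CommRing S]
    [Algebra R S] [Module.Flat R S] (M : Type u) [AddCommGroup M] [Module R M] (n : ℕ)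
    (h : HasProjectiveDimensionLT (ModuleCat.of R M) n) :
    HasProjectiveDimensionLT (ModuleCat.of S (S ⊗[R] M)) n := by
  induction n generalizing M with
  | zero =>
    rw [hasProjectiveDimensionLT_zero_iff_isZero, ModuleCat.isZero_of_iff_subsingleton] at h ⊢
    infer_instance
  | succ n ih =>
    match n with
    | 0 =>
      rw [zero_add, ← projective_iff_hasProjectiveDimensionLT_one,
        ← IsProjective.iff_projective] at h ⊢
      infer_instance
    | n + 1 =>
      obtain ⟨P, _, _, _, f, hf⟩ : ∃ (P : Type u) (_ : AddCommGroup P) (_ : Module R P)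
          (_ : Module.Projective R P) (f : P →ₗ[R] M), Function.Surjective f :=
        ⟨M →₀ R, _, _, inferInstance, _, Finsupp.linearCombination_id_surjective R M⟩
      have hex : Function.Exact ((LinearMap.ker f).subtype.lTensor S) (f.lTensor S) :=
        lTensor_exact S (LinearMap.exact_subtype_ker_map f) hf
      have hker := ih (LinearMap.ker f) <| (hasProjectiveDimensionLT_iff_of_exact
        (LinearMap.ker f).injective_subtype (LinearMap.exact_subtype_ker_map f) hf n).mp h
      have hinj : Function.Injective ((LinearMap.ker f).subtype.baseChange S) :=
        Module.Flat.lTensor_preserves_injective_linearMap (LinearMap.ker f).subtype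
          (LinearMap.ker f).injective_subtype
      have hsurj : Function.Surjective (f.baseChange S) := LinearMap.lTensor_surjective S hf
      have hex' : Function.Exact ((LinearMap.ker f).subtype.baseChange S) (f.baseChange S) := hex
      exact (hasProjectiveDimensionLT_iff_of_exact hinj hex' hsurj n).mpr hker

lemma ModuleCat.hasProjectiveDimensionLT_quotient_map {R S : Type u} [CommRing R] [CommRing S]
    (f : R →+* S) (hf : f.Flat) (I : Ideal R) (n : ℕ)
    (h : HasProjectiveDimensionLT (ModuleCat.of R (R ⧸ I)) n) :
    HasProjectiveDimensionLT (ModuleCat.of S (S ⧸ I.map f)) n := by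
  algebraize [f]
  have := ModuleCat.hasProjectiveDimensionLT_tensorProduct (S := S) (R ⧸ I) n h
  exact hasProjectiveDimensionLT_of_iso
    (Algebra.TensorProduct.quotIdealMapEquivTensorQuot S I).symm.toLinearEquiv.toModuleIso n

end ProjectiveDimension

section RegularSequence

open IsLocalRing RingTheory.Sequence

universe u

lemma RingTheory.Sequence.IsWeaklyRegular.append_singleton_of_exact {R K F M : Type*} [CommRing R]
    [AddCommGroup K] [Module R K] [AddCommGroup F] [Module R F] [AddCommGroup M] [Module R M]
    {f : K →ₗ[R] F} {g : F →ₗ[R] M} (hf : Function.Injective f) (hfg : Function.Exact f g)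
    (hg : Function.Surjective g) {rs : List R} {r : R} (hM : IsWeaklyRegular M rs)
    (hF : IsWeaklyRegular F (rs ++ [r])) : IsWeaklyRegular K (rs ++ [r]) := by
  induction hM generalizing K F with
  | nil =>
    simp only [List.nil_append, isWeaklyRegular_cons_iff] at hF ⊢
    exact ⟨hF.1.of_injective f hf, .nil _ _⟩
  | cons s rs hs hrs ih =>
    simp only [List.cons_append, isWeaklyRegular_cons_iff] at hF ⊢
    refine ⟨hF.1.of_injective f hf, ih (f := QuotSMulTop.map s f) (g := QuotSMulTop.map s g) ?_
      (QuotSMulTop.map_exact s hfg hg) (QuotSMulTop.map_surjective s hg) hF.2⟩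
    have := QuotSMulTop.map_first_exact_on_four_term_exact_of_isSMulRegular_last
      (f₁ := (0 : PUnit →ₗ[R] K)) ((LinearMap.exact_zero_iff_injective PUnit f).mpr hf) hfg hs
    rw [map_zero] at this
    exact (LinearMap.exact_zero_iff_injective _ _).mp this

open TensorProduct in
lemma RingTheory.Sequence.IsWeaklyRegular.of_flat_module {R : Type*} [CommRing R] {rs : List R}
    (h : IsWeaklyRegular R rs) (F : Type*) [AddCommGroup F] [Module R F] [Module.Flat R F] :
    IsWeaklyRegular F rs :=
  ((TensorProduct.rid R F).isWeaklyRegular_congr rs).mp (h.isWeaklyRegular_lTensor (M₂ := F))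

variable {R : Type u} [CommRing R] [IsLocalRing R]

lemma exists_linearEquiv_quotient_maximalIdeal_smul_top (M : Type u) [AddCommGroup M] [Module R M]
    [Module.Finite R M] : ∃ b : ℕ, Nonempty ((M ⧸ maximalIdeal R • (⊤ : Submodule R M)) ≃ₗ[R]
      ((Fin b → R) ⧸ maximalIdeal R • (⊤ : Submodule R (Fin b → R)))) := by
  let k := R ⧸ maximalIdeal R
  let := Ideal.Quotient.field (maximalIdeal R)
  have : Module.Finite k (M ⧸ maximalIdeal R • (⊤ : Submodule R M)) :=
    Module.Finite.of_restrictScalars_finite R _ _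
  let e := (Module.finBasis k (M ⧸ maximalIdeal R • (⊤ : Submodule R M))).equivFun
  exact ⟨_, ⟨(e.restrictScalars R).trans <| (TensorProduct.piScalarRight R R k _).symm.trans
    (TensorProduct.quotTensorEquivQuotSMul _ _)⟩⟩

variable [IsNoetherianRing R]

lemma ModuleCat.projectiveDimension_le_zero_of_isWeaklyRegular {rs : List R}
    (hrs : Ideal.ofList rs = maximalIdeal R) (h : IsWeaklyRegular R rs) (M : Type u)
    [AddCommGroup M] [Module R M] [Module.Finite R M] (hM : IsWeaklyRegular M rs) :
    projectiveDimension (ModuleCat.of R M) ≤ 0 := by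
  cases subsingleton_or_nontrivial M
  · rw [(projectiveDimension_eq_bot_iff _).mpr (ModuleCat.isZero_of_iff_subsingleton.mpr ‹_›)]
    exact bot_le
  have hmem : ∀ r ∈ rs, r ∈ maximalIdeal R := fun r hr ↦ hrs ▸ Ideal.subset_span hr
  obtain ⟨b, ⟨e⟩⟩ := exists_linearEquiv_quotient_maximalIdeal_smul_top (R := R) M
  have hMtop : maximalIdeal R • (⊤ : Submodule R M) ≠ ⊤ :=
    (Submodule.top_ne_ideal_smul_of_le_jacobson_annihilator
      (maximalIdeal_le_jacobson _)).symm
  have : Nontrivial (M ⧸ maximalIdeal R • (⊤ : Submodule R M)) :=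
    Submodule.Quotient.nontrivial_iff.mpr hMtop
  have := e.symm.nontrivial
  have : Nontrivial (Fin b → R) := (Submodule.mkQ_surjective
    (maximalIdeal R • (⊤ : Submodule R (Fin b → R)))).nontrivial
  rw [← hrs] at e
  have h₁ := projectiveDimension_quotient_eq_add_length_of_isWeaklyRegular (.of R M) rs hM hmem
  have : Nontrivial (ModuleCat.of R (Fin b → R)) := ‹_›
  have h₂ := projectiveDimension_quotient_eq_add_length_of_isWeaklyRegular
    (.of R (Fin b → R)) rs (h.of_flat_module _) hmem
  have h₃ : projectiveDimension (ModuleCat.of R (Fin b → R)) ≤ 0 :=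
    projectiveDimension_eq_zero_of_projective (R := R) _ |>.le
  rw [← ENat.WithBot.add_le_add_natCast_right_iff (c := rs.length), ← h₁,
    projectiveDimension_eq_of_iso e.toModuleIso]
  exact h₂.trans_le (by gcongr)

lemma ModuleCat.projectiveDimension_le_length {rs : List R}
    (hrs : Ideal.ofList rs = maximalIdeal R) (h : IsWeaklyRegular R rs) (M : Type u)
    [AddCommGroup M] [Module R M] [Module.Finite R M] :
    projectiveDimension (ModuleCat.of R M) ≤ rs.length := by
  suffices ∀ (n i : ℕ), n + i = rs.length → ∀ (M : Type u) [AddCommGroup M] [Module R M]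
      [Module.Finite R M], IsWeaklyRegular M (rs.take i) →
      HasProjectiveDimensionLT (ModuleCat.of R M) (n + 1) from
    (projectiveDimension_le_iff _ _).mpr (this _ 0 (add_zero _) M (by simp))
  intro n
  induction n with
  | zero =>
    intro i hi M _ _ _ hM
    rw [zero_add] at hi
    rw [hi, List.take_length] at hM
    exact (projectiveDimension_le_iff _ 0).mp
      (projectiveDimension_le_zero_of_isWeaklyRegular hrs h M hM)
  | succ n ih =>
    intro i hi M _ _ _ hM
    obtain ⟨F, _, _, _, _, f, hf⟩ := Module.exists_finite_presentation R M
    have hinj := (LinearMap.ker f).injective_subtype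
    have hex := LinearMap.exact_subtype_ker_map f
    refine (hasProjectiveDimensionLT_iff_of_exact hinj hex hf n).mpr
      (ih (i + 1) (by lia) _ ?_)
    have hi' : i < rs.length := by lia
    rw [← List.take_append_getElem hi']
    refine .append_singleton_of_exact hinj hex hf hM ?_
    rw [List.take_append_getElem hi']
    have := h.of_flat_module F
    rw [← List.take_append_drop (i + 1) rs, isWeaklyRegular_append_iff] at this
    exact this.1

end RegularSequence

section ExtComparison

universe u

variable {R : Type u} [CommRing R] {X Y : ModuleCat.{u} R}

lemma CategoryTheory.ProjectiveResolution.subsingleton_ext_iff (P : ProjectiveResolution X)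
    {n m : ℕ} (hm : n + 1 = m) (i : ℕ) (hi : (ComplexShape.up ℕ).prev n = i) :
    Subsingleton (((Ext R (ModuleCat.{u} R) n).obj (Opposite.op X)).obj Y) ↔
      ∀ f : P.complex.X n ⟶ Y, P.complex.d m n ≫ f = 0 →
        ∃ g : P.complex.X i ⟶ Y, P.complex.d n i ≫ g = f := by
  have e := P.isoExt (R := R) n Y
  rw [← ModuleCat.isZero_iff_subsingleton, e.isZero_iff,
    ← HomologicalComplex.exactAt_iff_isZero_homology,
    HomologicalComplex.exactAt_iff' _ i n m hi (by subst hm; simp),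
    ShortComplex.moduleCat_exact_iff]
  exact Iff.rfl

lemma ModuleCat.subsingleton_ext_iff_subsingleton_abelianExt (n : ℕ) :
    Subsingleton (((Ext R (ModuleCat.{u} R) n).obj (Opposite.op X)).obj Y) ↔
      Subsingleton (Abelian.Ext X Y n) := by
  let P := ProjectiveResolution.of X
  obtain _ | n := n
  · rw [P.subsingleton_ext_iff rfl 0 (by simp), Abelian.Ext.homEquiv₀.subsingleton_congr]
    have hd : P.complex.d 0 0 = 0 := P.complex.shape _ _ (by simp)
    simp only [hd, Limits.zero_comp, exists_const]
    constructor
    · refine fun h ↦ subsingleton_of_forall_eq (0 : X ⟶ Y) fun a ↦ ?_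
      let a' : ((ChainComplex.single₀ (ModuleCat.{u} R)).obj X).X 0 ⟶ Y := a
      change a' = 0
      rw [← cancel_epi (P.π.f 0), Limits.comp_zero]
      exact (h _ (by rw [zero_add, P.complex_d_comp_π_f_zero_assoc, Limits.zero_comp])).symm
    · intro h f hf
      obtain ⟨l, hl⟩ := Limits.CokernelCofork.IsColimit.desc' P.isColimitCokernelCofork f hf
      have hl' : l = 0 := h.elim l 0
      rw [← hl, hl', Limits.comp_zero]
  · rw [P.subsingleton_ext_iff rfl n (by simp)]
    constructor
    · refine fun h ↦ subsingleton_of_forall_eq 0 fun α ↦ ?_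
      obtain ⟨f, hf, rfl⟩ := P.extMk_surjective α (n + 2) rfl
      exact (P.extMk_eq_zero_iff f _ rfl hf n rfl).mpr (h f hf)
    · intro h f hf
      exact (P.extMk_eq_zero_iff f _ rfl hf n rfl).mp (Subsingleton.elim _ _)

end ExtComparison

section Colimit

open Limits

universe u v

lemma ModuleCat.subsingleton_colimit_obj {R : Type u} [CommRing R] {D : Type u} [SmallCategory D]
    {A : Type v} [Category.{u} A] (F : D ⥤ A ⥤ ModuleCat.{u} R) (M : A)
    (h : ∀ d, ∃ d', Nonempty (d ⟶ d') ∧ Subsingleton ((F.obj d').obj M)) :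
    Subsingleton ((colimit F).obj M) := by
  have hc : IsColimit (((evaluation A (ModuleCat.{u} R)).obj M).mapCocone (colimit.cocone F)) :=
    isColimitOfPreserves _ (colimit.isColimit F)
  rw [← ModuleCat.isZero_iff_subsingleton, IsZero.iff_id_eq_zero]
  refine hc.hom_ext fun d ↦ ?_
  obtain ⟨d', ⟨f⟩, hd'⟩ := h d
  have := (ModuleCat.isZero_iff_subsingleton.mpr hd').eq_zero_of_tgt ((F.map f).app M)
  have h2 : (colimit.ι F d).app M = 0 := by
    rw [← colimit.w F f, NatTrans.comp_app, this, zero_comp]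
  simp [h2]

lemma localCohomology.subsingleton_obj {R : Type u} [CommRing R] [IsNoetherianRing R] (I : Ideal R)
    (i : ℕ) (M : ModuleCat.{u} R)
    (h : ∀ J : Ideal R, I ≤ J.radical → ∃ J' ≤ J, I ≤ J'.radical ∧
      Subsingleton (Abelian.Ext (ModuleCat.of R (R ⧸ J')) M i)) :
    Subsingleton ((localCohomology I i).obj M) := by
  have : Subsingleton ((localCohomology.ofSelfLERadical I i).obj M) := by
    refine ModuleCat.subsingleton_colimit_obj _ M fun d ↦ ?_
    obtain ⟨J', hJ', hI, hs⟩ := h d.unop.obj d.unop.property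
    exact ⟨.op ⟨J', hI⟩, ⟨Quiver.Hom.op (ObjectProperty.homMk (homOfLE hJ'))⟩,
      ModuleCat.subsingleton_ext_iff_subsingleton_abelianExt i |>.mpr hs⟩
  rw [← ModuleCat.isZero_iff_subsingleton] at this ⊢
  exact this.of_iso ((localCohomology.isoSelfLERadical I i).app M).symm

end Colimit

section Frobenius

lemma RingHom.Flat.iterateFrobenius {R : Type*} [CommRing R] {p : ℕ} [ExpChar R p]
    (h : (frobenius R p).Flat) (e : ℕ) : (iterateFrobenius R p e).Flat := by
  induction e with
  | zero => rw [iterateFrobenius_zero]; exact .id R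
  | succ e ih =>
    have : _root_.iterateFrobenius R p (e + 1) =
        (_root_.iterateFrobenius R p e).comp (frobenius R p) := by
      ext x
      simp [iterateFrobenius_def, frobenius_def, ← pow_mul, pow_succ']
    rw [this]
    exact h.comp ih

lemma Ideal.exists_map_iterateFrobenius_le {R : Type*} [CommRing R] {p : ℕ} [ExpChar R p]
    (hp : 1 < p) {I J : Ideal R} (hI : I.FG) (h : I ≤ J.radical) :
    ∃ e, I.map (iterateFrobenius R p e) ≤ J := by
  obtain ⟨N, hN⟩ := Ideal.exists_pow_le_of_le_radical_of_fg h hI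
  obtain ⟨e, he⟩ := pow_unbounded_of_one_lt N hp
  refine ⟨e, Ideal.map_le_iff_le_comap.mpr fun x hx ↦ hN (Ideal.pow_le_pow_right he.le ?_)⟩
  exact Ideal.pow_mem_pow hx _

lemma Ideal.le_radical_map_iterateFrobenius {R : Type*} [CommRing R] (p : ℕ) [ExpChar R p]
    (I : Ideal R) (e : ℕ) : I ≤ (I.map (iterateFrobenius R p e)).radical :=
  fun _ hx ↦ ⟨p ^ e, Ideal.mem_map_of_mem (iterateFrobenius R p e) hx⟩

universe u

lemma localCohomology.subsingleton_obj_of_hasProjectiveDimensionLT {R : Type u} [CommRing R]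
    [IsNoetherianRing R] (p : ℕ) [Fact p.Prime] [CharP R p] (h : (frobenius R p).Flat)
    (I : Ideal R) (j : ℕ) (hI : HasProjectiveDimensionLT (ModuleCat.of R (R ⧸ I)) j)
    (M : ModuleCat.{u} R) : Subsingleton ((localCohomology I j).obj M) := by
  refine localCohomology.subsingleton_obj I j M fun J hJ ↦ ?_
  obtain ⟨e, he⟩ := Ideal.exists_map_iterateFrobenius_le (Fact.out : p.Prime).one_lt
    (IsNoetherian.noetherian I) hJ
  have := ModuleCat.hasProjectiveDimensionLT_quotient_map _ (h.iterateFrobenius e) I j hI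
  exact ⟨_, he, I.le_radical_map_iterateFrobenius p e,
    HasProjectiveDimensionLT.subsingleton _ j j le_rfl M⟩

end Frobenius

section Depth

open IsLocalRing RingTheory.Sequence

universe u

lemma ModuleCat.projectiveDimension_add_le_of_subsingleton_ext {R : Type u} [CommRing R]
    [IsLocalRing R] [IsNoetherianRing R] {rs : List R} (hrs : Ideal.ofList rs = maximalIdeal R)
    (h : IsWeaklyRegular R rs) (M : Type u) [AddCommGroup M] [Module R M] [Module.Finite R M]
    [Nontrivial M] {d : ℕ} (hd : ∀ i < d, Subsingleton
      (Abelian.Ext (ModuleCat.of R (R ⧸ maximalIdeal R)) (ModuleCat.of R M) i)) :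
    projectiveDimension (ModuleCat.of R M) + d ≤ rs.length := by
  have hM : maximalIdeal R • (⊤ : Submodule R M) < ⊤ :=
    (Submodule.top_ne_ideal_smul_of_le_jacobson_annihilator
      (maximalIdeal_le_jacobson _)).symm.lt_top
  obtain ⟨ys, hys, hmem, hreg⟩ := exists_isRegular_of_exists_subsingleton_ext (maximalIdeal R) d
    (.of R M) hM (.of R (R ⧸ maximalIdeal R))
    (by rw [Module.support_eq_zeroLocus, Ideal.annihilator_quotient]) hd
  rw [← hys, ← projectiveDimension_quotient_eq_add_length_of_isWeaklyRegular (.of R M) ys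
    hreg.toIsWeaklyRegular hmem]
  exact projectiveDimension_le_length hrs h _

lemma subsingleton_ext_of_lt_moduleDepth {R : Type} [CommRing R] [IsLocalRing R] {M : Type}
    [AddCommGroup M] [Module R M] {i : ℕ} (hi : (i : ℕ∞) < moduleDepth R M) :
    Subsingleton
      (Abelian.Ext (ModuleCat.of R (R ⧸ maximalIdeal R)) (ModuleCat.of R M) i) := by
  rw [← ModuleCat.subsingleton_ext_iff_subsingleton_abelianExt, ← not_nontrivial_iff_subsingleton]
  exact fun h ↦ notMem_of_lt_csInf hi (OrderBot.bddBelow _) ⟨i, rfl, h⟩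

lemma ENat.exists_natCast_le_of_sub_lt {n j : ℕ} {a : ℕ∞} (h : (n : ℕ∞) - a < j) :
    ∃ d : ℕ, (d : ℕ∞) ≤ a ∧ n < j + d := by
  induction a with
  | top => exact ⟨n, le_top, by simp at h; lia⟩
  | coe a => exact ⟨a, le_rfl, by norm_cast at h; lia⟩

end Depth

/-- **Peskine–Szpiro vanishing.** Let `(R, 𝔪)` be a Noetherian regular local ring of prime
characteristic `p` (regularity: `𝔪` is generated by `dim R` elements) and `I` a proper ideal.
Then `H^j_I(R) = 0` for every `j > dim R - depth (R/I)`. -/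
theorem peskine_szpiro_vanishing
    (R : Type) [CommRing R] [IsNoetherianRing R] [IsLocalRing R]
    (p : ℕ) (hp : p.Prime) [CharP R p]
    (hreg : ∃ s : Finset R, Ideal.span (s : Set R) = IsLocalRing.maximalIdeal R ∧
      (s.card : WithBot ℕ∞) = ringKrullDim R)
    (I : Ideal R) (hI : I ≠ ⊤)
    (n : ℕ) (hn : (n : WithBot ℕ∞) = ringKrullDim R)
    (j : ℕ) (hj : (n : ℕ∞) - moduleDepth R (R ⧸ I) < (j : ℕ∞)) :
    Subsingleton ((localCohomology I j).obj (ModuleCat.of R R)) := by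
  have := Fact.mk hp
  obtain ⟨s, hs, hcard⟩ := hreg
  have hlen : s.toList.length = n := by
    rw [Finset.length_toList]
    exact_mod_cast hcard.trans hn.symm
  have hspan : Ideal.ofList s.toList = IsLocalRing.maximalIdeal R := by
    simpa [Ideal.ofList] using hs
  have hreg := (isDomain_and_isWeaklyRegular_of_ofList_eq_maximalIdeal s.toList hspan
    (by rw [hlen, hn])).2
  have : Nontrivial (R ⧸ I) := Ideal.Quotient.nontrivial_iff.mpr hI
  obtain ⟨d, hd, hnj⟩ := ENat.exists_natCast_le_of_sub_lt hj
  have hpd := ModuleCat.projectiveDimension_add_le_of_subsingleton_ext hspan hreg (R ⧸ I)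
    fun i hi ↦ subsingleton_ext_of_lt_moduleDepth ((Nat.cast_lt.mpr hi).trans_le hd)
  refine localCohomology.subsingleton_obj_of_hasProjectiveDimensionLT p
    (flat_frobenius_of_isWeaklyRegular p hspan hreg) I j ?_ _
  rw [← projectiveDimension_lt_iff]
  by_contra! hlt
  have : ((j + d : ℕ) : WithBot ℕ∞) ≤ n := by
    rw [← hlen, Nat.cast_add]
    exact (add_le_add_left hlt _).trans hpd
  have : j + d ≤ n := by exact_mod_cast this
  lia
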